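/- arXiv:2403.17730 — 2 statements merged into one kernel-verified Lean document; each statement's English description precedes it below -/
import Mathlib

section
/- For every d ∈ G and c ∈ ℝ⟨⟨X⟩⟩, applying the componentwise composition product to the ⊙-inverse commutes with inversion: (d^{⊙−1}) ∘̄ c = (d ∘̄ c)^{⊙−1}; explicitly, for d = (d₁, d₂), (d^{⊙−1}) ∘̄ c = ((d₁ ∘ c)^{⧢−1}, −(d₁ ∘ c)^{⧢−1} ⧢ (d₂ ∘ c)). -/
open scoped Classical

/-!  Common setup: noncommutative formal power series ℝ⟨⟨X⟩⟩ over the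
alphabet X = {x₀, x₁}.  Words are encoded as lists over `Fin 2`
(the letter `0` is x₀ and `1` is x₁); a series is a function from words
to ℝ, recording its coefficients. -/

/-- Words over the alphabet X = {x₀, x₁}. -/
abbrev Word : Type := List (Fin 2)

/-- Noncommutative formal power series ℝ⟨⟨X⟩⟩. -/
abbrev Ser : Type := Word → ℝ

/-- The series 𝟙 (the empty word). -/
def one1 : Ser := fun w => if w = [] then 1 else 0

/-- A single word η regarded as a series. -/
def mono (η : Word) : Ser := fun w => if w = η then 1 else 0

/-- Left concatenation of a series by the letter `x_i`. -/
def lc (i : Fin 2) (c : Ser) : Ser := fun w =>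
  match w with
  | [] => 0
  | j :: u => if j = i then c u else 0

/-- Auxiliary recursion computing the coefficient of a word `w` in `c ⧢ d`:
`(c ⧢ d)(𝟙) = c(𝟙) d(𝟙)` and
`(c ⧢ d)(x_i w) = ((x_i⁻¹ c) ⧢ d)(w) + (c ⧢ (x_i⁻¹ d))(w)`,
where `x_i⁻¹` is the left shift.  This dual recursion is exactly the
bilinear extension of the inductive shuffle of words
`(x_i ξ) ⧢ (x_j η) = x_i (ξ ⧢ x_j η) + x_j (x_i ξ ⧢ η)`, `𝟙 ⧢ η = η ⧢ 𝟙 = η`. -/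
def shAux : Word → Ser → Ser → ℝ
  | [], c, d => c [] * d []
  | i :: w, c, d => shAux w (fun u => c (i :: u)) d + shAux w c (fun u => d (i :: u))

/-- The shuffle product `⧢` on ℝ⟨⟨X⟩⟩. -/
def sh (c d : Ser) : Ser := fun w => shAux w c d

/-- Shuffle powers `c^{⧢ k}`. -/
def shPow (c : Ser) : ℕ → Ser
  | 0 => one1
  | k + 1 => sh c (shPow c k)

/-- The shuffle inverse `c^{⧢ -1} = Σ_{k ≥ 0} (𝟙 - c)^{⧢ k}`.
When `c(𝟙) = 1` the sum is locally finite (for each word only finitely many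
terms are nonzero) and `∑'` returns it. -/
noncomputable def shInv (c : Ser) : Ser := fun w => ∑' k : ℕ, shPow (one1 - c) k w

/-- Composition product restricted to words: `𝟙 ∘ d = 𝟙`,
`(x₀ η) ∘ d = x₀ (η ∘ d)`, `(x₁ η) ∘ d = x₀ (d ⧢ (η ∘ d))`. -/
def wordComp : Word → Ser → Ser
  | [], _ => one1
  | i :: η, d => if i = 0 then lc 0 (wordComp η d) else lc 0 (sh d (wordComp η d))

/-- The composition product `c ∘ d = Σ_η c(η) (η ∘ d)`.  For each fixed word
only finitely many terms are nonzero, and `∑'` returns the sum. -/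
noncomputable def comp (c d : Ser) : Ser := fun w => ∑' η : Word, c η * wordComp η d w

/-- Membership in the set `G`: pairs `(d₁, d₂)` with `d₁(𝟙) = 1`. -/
def inG (d : Ser × Ser) : Prop := d.1 [] = 1

/-- Mixed composition product restricted to words: `𝟙 ◁ d = 𝟙`,
`(x₀ η) ◁ d = x₀ (η ◁ d)`,
`(x₁ η) ◁ d = x₁ (d₁ ⧢ (η ◁ d)) + x₀ (d₂ ⧢ (η ◁ d))`. -/
def wordMComp : Word → Ser × Ser → Ser
  | [], _ => one1
  | i :: η, d =>
      if i = 0 then lc 0 (wordMComp η d)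
      else lc 1 (sh d.1 (wordMComp η d)) + lc 0 (sh d.2 (wordMComp η d))

/-- The mixed composition product `c ◁ d = Σ_η c(η) (η ◁ d)`. -/
noncomputable def mcomp (c : Ser) (d : Ser × Ser) : Ser :=
  fun w => ∑' η : Word, c η * wordMComp η d w

/-- Componentwise mixed composition `c ⊲ d = (c₁ ◁ d, c₂ ◁ d)`. -/
noncomputable def tri (c d : Ser × Ser) : Ser × Ser := (mcomp c.1 d, mcomp c.2 d)

/-- Componentwise composition `d ∘̄ c = (d₁ ∘ c, d₂ ∘ c)`. -/
noncomputable def bcomp (d : Ser × Ser) (c : Ser) : Ser × Ser := (comp d.1 c, comp d.2 c)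

/-- The group product `⊙` on `G`:
`(c₁, c₂) ⊙ (d₁, d₂) = (c₁ ⧢ d₁, c₂ + d₂ ⧢ c₁)`. -/
def odot (c d : Ser × Ser) : Ser × Ser := (sh c.1 d.1, c.2 + sh d.2 c.1)

/-- The identity element `e = (𝟙, 0)`. -/
def eG : Ser × Ser := (one1, 0)

/-- The `⊙`-inverse `c^{⊙ -1} = (c₁^{⧢ -1}, -(c₁^{⧢ -1} ⧢ c₂))`. -/
noncomputable def odotInv (c : Ser × Ser) : Ser × Ser :=
  (shInv c.1, -(sh (shInv c.1) c.2))

/-- The affine feedback group product `c ⋆ d = (c ⊲ d) ⊙ d` on `G`. -/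
noncomputable def star (c d : Ser × Ser) : Ser × Ser := odot (tri c d) d

/-- The `⋆`-inverse of an element of `G` (defined via choice; for an element
of the group `(G, ⋆)` it is the unique two-sided `⋆`-inverse). -/
noncomputable def starInv (x : Ser × Ser) : Ser × Ser :=
  if h : ∃ y : Ser × Ser, inG y ∧ star x y = eG ∧ star y x = eG then h.choose else x

/-- The affine feedback product `c @ d = c ◁ ((d^{⊙ -1}) ∘̄ c)^{⋆ -1}`. -/
noncomputable def atp (c : Ser) (d : Ser × Ser) : Ser :=
  mcomp c (starInv (bcomp (odotInv d) c))

/-- Membership in ℝ[[x₀]]: series vanishing on every word containing x₁. -/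
def inRx0 (c : Ser) : Prop := ∀ w : Word, (1 : Fin 2) ∈ w → c w = 0

/-- The left shift `x_i⁻¹ c`. -/
def leftShift (i : Fin 2) (c : Ser) : Ser := fun u => c (i :: u)

lemma sh_nil (a b : Ser) : sh a b [] = a [] * b [] := rfl

lemma sh_cons (a b : Ser) (i : Fin 2) (w : Word) :
    sh a b (i :: w) = sh (leftShift i a) b w + sh a (leftShift i b) w := rfl

lemma leftShift_add (i : Fin 2) (a b : Ser) :
    leftShift i (a + b) = leftShift i a + leftShift i b := rfl

lemma leftShift_smul (i : Fin 2) (r : ℝ) (a : Ser) :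
    leftShift i (r • a) = r • leftShift i a := rfl

lemma leftShift_sh (i : Fin 2) (a b : Ser) :
    leftShift i (sh a b) = sh (leftShift i a) b + sh a (leftShift i b) := rfl

lemma sh_comm (a b : Ser) : sh a b = sh b a := by
  funext w
  induction w generalizing a b with
  | nil => simp only [sh_nil, mul_comm]
  | cons i w ih =>
    rw [sh_cons, sh_cons, ih (leftShift i a), ih a, add_comm]

lemma sh_add (a b c : Ser) : sh a (b + c) = sh a b + sh a c := by
  funext w
  induction w generalizing a b c with
  | nil => simp only [sh_nil, Pi.add_apply, mul_add]
  | cons i w ih =>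
    simp only [Pi.add_apply, sh_cons, leftShift_add, ih]
    ring

lemma add_sh (a b c : Ser) : sh (a + b) c = sh a c + sh b c := by
  rw [sh_comm, sh_add, sh_comm c a, sh_comm c b]

lemma sh_smul (a b : Ser) (r : ℝ) : sh a (r • b) = r • sh a b := by
  funext w
  induction w generalizing a b with
  | nil =>
    simp only [sh_nil, Pi.smul_apply, smul_eq_mul]
    ring
  | cons i w ih =>
    simp only [sh_cons, leftShift_smul, ih, Pi.smul_apply, smul_eq_mul]
    ring

lemma sh_assoc (a b c : Ser) : sh (sh a b) c = sh a (sh b c) := by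
  funext w
  induction w generalizing a b c with
  | nil => simp only [sh_nil, mul_assoc]
  | cons i w ih =>
    simp only [sh_cons, leftShift_sh, add_sh, sh_add, Pi.add_apply, ih]
    ring

/-- Shuffling by a fixed series on the left, as a linear map. -/
def shLeft (a : Ser) : Ser →ₗ[ℝ] Ser where
  toFun := sh a
  map_add' := sh_add a
  map_smul' r b := sh_smul a b r

lemma shLeft_apply (a b : Ser) : shLeft a b = sh a b := rfl

/-- The coefficient of `a ⧢ b` at `w` depends only on coefficients of `b` at words no longer
than `w`. -/
lemma sh_congr_right {a b b' : Ser} {w : Word}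
    (h : ∀ u : Word, u.length ≤ w.length → b u = b' u) : sh a b w = sh a b' w := by
  induction w generalizing a b b' with
  | nil => simp only [sh_nil, h [] le_rfl]
  | cons i w ih =>
    rw [sh_cons, sh_cons, ih fun u hu => h u (hu.trans (by simp)),
      ih (b := leftShift i b) (b' := leftShift i b') fun u hu => h (i :: u) (by simpa using hu)]

lemma sh_eq_zero_of_length_lt {p q : Ser} (hp : p [] = 0) {k : ℕ}
    (hq : ∀ u : Word, u.length < k → q u = 0) {w : Word} (hw : w.length < k + 1) :
    sh p q w = 0 := by
  induction w generalizing q k with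
  | nil => rw [sh_nil, hp, zero_mul]
  | cons i w ih =>
    obtain ⟨k, rfl⟩ : ∃ m, k = m + 1 :=
      Nat.exists_eq_succ_of_ne_zero (by simp at hw; omega)
    simp only [List.length_cons] at hw
    have h₁ : sh (leftShift i p) q w = 0 := by
      rw [sh_congr_right (b' := 0) fun u hu => hq u (by omega), ← shLeft_apply, map_zero]
      rfl
    have h₂ : sh p (leftShift i q) w = 0 :=
      ih (fun u hu => hq (i :: u) (by simpa using hu)) (by omega)
    rw [sh_cons, h₁, h₂, add_zero]

lemma shPow_eq_zero_of_length_lt {p : Ser} (hp : p [] = 0) {k : ℕ} {w : Word}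
    (hw : w.length < k) : shPow p k w = 0 := by
  induction k generalizing w with
  | zero => omega
  | succ k ih => exact sh_eq_zero_of_length_lt hp (fun u hu => ih hu) hw

lemma shInv_apply_eq_sum {a : Ser} (ha : a [] = 1) {n : ℕ} {w : Word} (hw : w.length ≤ n) :
    shInv a w = (∑ k ∈ Finset.range (n + 1), shPow (one1 - a) k) w := by
  rw [Finset.sum_apply]
  refine tsum_eq_sum fun k hk => shPow_eq_zero_of_length_lt (by simp [one1, ha]) ?_
  simp only [Finset.mem_range, not_lt] at hk
  omega

lemma wordComp_eq_zero_of_length_lt {η : Word} (d : Ser) {w : Word}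
    (h : w.length < η.length) : wordComp η d w = 0 := by
  induction η generalizing w with
  | nil => simp at h
  | cons i η ih =>
    cases w with
    | nil =>
      rw [wordComp]
      split_ifs <;> rfl
    | cons j w =>
      simp only [List.length_cons, add_lt_add_iff_right] at h
      have h₂ : sh d (wordComp η d) w = 0 := by
        rw [sh_congr_right (b' := 0) fun u hu => ih (by omega), ← shLeft_apply, map_zero]
        rfl
      rw [wordComp]
      split_ifs <;> simp [lc, ih h, h₂]

/-- The finite set of words of length at most `n`. -/
noncomputable def wordsUpTo (n : ℕ) : Finset Word :=
  (List.finite_length_le (Fin 2) n).toFinset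

lemma mem_wordsUpTo {n : ℕ} {w : Word} : w ∈ wordsUpTo n ↔ w.length ≤ n := by
  simp [wordsUpTo]

lemma comp_apply_eq_sum (c d : Ser) {n : ℕ} {w : Word} (hw : w.length ≤ n) :
    comp c d w = (∑ η ∈ wordsUpTo n, c η • wordComp η d) w := by
  rw [Finset.sum_apply]
  refine tsum_eq_sum fun η hη => ?_
  rw [mem_wordsUpTo, not_le] at hη
  rw [wordComp_eq_zero_of_length_lt d (by omega), mul_zero]

/-- Right composition with a fixed series, as a linear map. -/
noncomputable def compRight (d : Ser) : Ser →ₗ[ℝ] Ser where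
  toFun c := comp c d
  map_add' a b := by
    funext w
    simp only [Pi.add_apply, comp_apply_eq_sum _ d le_rfl, Finset.sum_apply, Pi.smul_apply,
      add_smul, Finset.sum_add_distrib]
  map_smul' r a := by
    funext w
    simp only [comp_apply_eq_sum _ d le_rfl, Finset.sum_apply, Pi.smul_apply,
      RingHom.id_apply, Finset.smul_sum, smul_assoc]

lemma compRight_apply (c d : Ser) : compRight d c = comp c d := rfl

lemma comp_congr_left {c c' : Ser} (d : Ser) {w : Word}
    (h : ∀ u : Word, u.length ≤ w.length → c u = c' u) : comp c d w = comp c' d w := by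
  rw [comp_apply_eq_sum c d le_rfl, comp_apply_eq_sum c' d le_rfl]
  refine congrFun ?_ w
  exact Finset.sum_congr rfl fun η hη => by rw [h η (mem_wordsUpTo.1 hη)]

lemma comp_nil (c d : Ser) : comp c d [] = c [] := by
  have h : ∀ η : Word, η ≠ [] → c η * wordComp η d [] = 0 := fun η hη => by
    rw [wordComp_eq_zero_of_length_lt d (w := []) (List.length_pos_iff.2 hη), mul_zero]
  rw [comp, tsum_eq_single [] h]
  simp [wordComp, one1]

lemma one1_comp (d : Ser) : comp one1 d = one1 := by
  funext w
  rw [comp, tsum_eq_single [] fun η hη => by simp [one1, hη]]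
  simp [wordComp, one1]

lemma leftShift_zero_comp (c d : Ser) :
    leftShift 0 (comp c d) =
      comp (leftShift 0 c) d + sh d (comp (leftShift 1 c) d) := by
  funext w
  have hinj : Function.Injective fun p : Fin 2 × Word => p.1 :: p.2 := by
    rintro ⟨i, u⟩ ⟨j, v⟩ h
    simpa using h
  have hsupp : (Function.support fun η => c η * wordComp η d (0 :: w)) ⊆
      Set.range fun p : Fin 2 × Word => p.1 :: p.2 := by
    intro η hη
    cases η with
    | nil => simp [wordComp, one1] at hη
    | cons i η => exact ⟨(i, η), rfl⟩
  have hsum : Summable fun p : Fin 2 × Word =>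
      c (p.1 :: p.2) * wordComp (p.1 :: p.2) d (0 :: w) := by
    refine summable_of_ne_finset_zero (s := Finset.univ ×ˢ wordsUpTo w.length) fun p hp => ?_
    simp only [Finset.mem_product, Finset.mem_univ, true_and, mem_wordsUpTo, not_le] at hp
    rw [wordComp_eq_zero_of_length_lt d (by simpa using hp), mul_zero]
  have hshift : leftShift 0 (comp c d) w =
      ∑' p : Fin 2 × Word, c (p.1 :: p.2) * wordComp (p.1 :: p.2) d (0 :: w) :=
    (hinj.tsum_eq hsupp).symm
  have hzero (η : Word) : wordComp (0 :: η) d (0 :: w) = wordComp η d w := by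
    simp [wordComp, lc]
  have hone (η : Word) : wordComp (1 :: η) d (0 :: w) = sh d (wordComp η d) w := by
    simp [wordComp, lc]
  have hsh : ∑' η, c (1 :: η) * sh d (wordComp η d) w = sh d (comp (leftShift 1 c) d) w := by
    rw [sh_congr_right fun u hu => comp_apply_eq_sum (leftShift 1 c) d hu, ← shLeft_apply,
      map_sum, Finset.sum_apply]
    simp only [map_smul]
    refine tsum_eq_sum fun η hη => ?_
    rw [mem_wordsUpTo, not_le] at hη
    rw [← hone, wordComp_eq_zero_of_length_lt d (by simpa using hη), mul_zero]
  rw [hshift, hsum.tsum_prod, tsum_fintype, Fin.sum_univ_two]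
  simp only [hzero, hone, hsh]
  rfl

lemma comp_one_cons (c d : Ser) (w : Word) : comp c d (1 :: w) = 0 := by
  have h (η : Word) : wordComp η d (1 :: w) = 0 := by
    cases η with
    | nil => simp [wordComp, one1]
    | cons i η =>
      rw [wordComp]
      split_ifs <;> simp [lc]
  simp [comp, h]

lemma leftShift_one_comp (c d : Ser) : leftShift 1 (comp c d) = 0 :=
  funext (comp_one_cons c d)

lemma comp_add (a b d : Ser) : comp (a + b) d = comp a d + comp b d := map_add (compRight d) a b

/-- Right composition is multiplicative for the shuffle product. -/
lemma sh_comp (a b c : Ser) : comp (sh a b) c = sh (comp a c) (comp b c) := by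
  suffices h : ∀ (n : ℕ) (w : Word), w.length ≤ n → ∀ a b : Ser,
      comp (sh a b) c w = sh (comp a c) (comp b c) w from
    funext fun w => h _ w le_rfl a b
  intro n
  induction n with
  | zero =>
    intro w hw a b
    obtain rfl : w = [] := List.length_eq_zero_iff.1 (Nat.le_zero.1 hw)
    simp only [comp_nil, sh_nil]
  | succ n ih =>
    intro w hw a b
    cases w with
    | nil => simp only [comp_nil, sh_nil]
    | cons i w =>
      have hn : w.length ≤ n := by simpa using hw
      have hsh (a b : Ser) :
          sh c (comp (sh a b) c) w = sh c (sh (comp a c) (comp b c)) w :=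
        sh_congr_right fun u hu => ih u (hu.trans hn) a b
      match i with
      | 0 =>
        change leftShift 0 (comp (sh a b) c) w = _
        rw [sh_cons]
        simp only [leftShift_zero_comp, leftShift_sh, comp_add, sh_add, add_sh, Pi.add_apply,
          ih w hn, hsh]
        rw [sh_assoc c, ← sh_assoc (comp a c) c, sh_comm (comp a c) c, sh_assoc c]
        ring
      | 1 =>
        have h_zero : sh 0 (comp b c) = 0 := by rw [sh_comm, ← shLeft_apply, map_zero]
        rw [comp_one_cons, sh_cons, leftShift_one_comp, leftShift_one_comp, h_zero,
          ← shLeft_apply, map_zero]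
        simp

lemma shPow_comp (a c : Ser) (k : ℕ) : comp (shPow a k) c = shPow (comp a c) k := by
  induction k with
  | zero => exact one1_comp c
  | succ k ih => rw [shPow, sh_comp, ih, shPow]

/-- Right composition commutes with the shuffle inverse. -/
lemma shInv_comp {a : Ser} (ha : a [] = 1) (c : Ser) :
    comp (shInv a) c = shInv (comp a c) := by
  funext w
  have hsub : comp (one1 - a) c = one1 - comp a c := by
    rw [← compRight_apply, map_sub, compRight_apply, compRight_apply, one1_comp]
  rw [comp_congr_left c fun u hu => shInv_apply_eq_sum ha hu,
    shInv_apply_eq_sum ((comp_nil a c).trans ha) le_rfl, ← compRight_apply, map_sum]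
  simp only [compRight_apply, shPow_comp, hsub]

/-- applying the componentwise composition product to the
`⊙`-inverse commutes with inversion: `(d^{⊙-1}) ∘̄ c = (d ∘̄ c)^{⊙-1}`;
explicitly, for `d = (d₁, d₂)`,
`(d^{⊙-1}) ∘̄ c = ((d₁ ∘ c)^{⧢-1}, -((d₁ ∘ c)^{⧢-1} ⧢ (d₂ ∘ c)))`. -/
theorem bcomp_odotInv (d : Ser × Ser) (hd : inG d) (c : Ser) :
    bcomp (odotInv d) c = odotInv (bcomp d c) ∧
    bcomp (odotInv d) c =
      (shInv (comp d.1 c), -(sh (shInv (comp d.1 c)) (comp d.2 c))) := by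
  have h : bcomp (odotInv d) c = odotInv (bcomp d c) := by
    simp only [bcomp, odotInv]
    rw [← compRight_apply (-_), map_neg, compRight_apply, sh_comp, shInv_comp hd]
  exact ⟨h, h⟩
end

section
/- Structural non-commutativity of additive and multiplicative feedback loops: for every plant series c ∈ ℝ⟨⟨X⟩⟩, every d₁ ∈ M and every d₂ ∈ ℝ⟨⟨X⟩⟩, the four successive feedbacks satisfy (((c @ (𝟙, d₂)) @ (d₁, 0)) @ (𝟙, −d₂)) @ (d₁^{⧢−1}, 0) = c @ (𝟙, d₂ ⧢ (𝟙 − d₁)), i.e., the additive and multiplicative loops do not cancel but leave a residual additive feedback by d₂ ⧢ (𝟙 − d₁). -/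
open scoped Classical

namespace Ser

/-- The left shift `x_i⁻¹ c`. -/
def shift (i : Fin 2) (c : Ser) : Ser := fun w => c (i :: w)

/-- Two series agree on all words of length less than `n`. -/
def Agree (n : ℕ) (c d : Ser) : Prop := ∀ w : Word, w.length < n → c w = d w

theorem Agree.refl (n : ℕ) (c : Ser) : Agree n c c := fun _ _ => rfl

theorem Agree.of_eq {n : ℕ} {c d : Ser} (h : c = d) : Agree n c d := h ▸ Agree.refl n c

theorem Agree.symm {n : ℕ} {c d : Ser} (h : Agree n c d) : Agree n d c :=
  fun w hw => (h w hw).symm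

theorem Agree.trans {n : ℕ} {c d e : Ser} (h : Agree n c d) (h' : Agree n d e) : Agree n c e :=
  fun w hw => (h w hw).trans (h' w hw)

theorem Agree.mono {m n : ℕ} (hmn : m ≤ n) {c d : Ser} (h : Agree n c d) : Agree m c d :=
  fun w hw => h w (hw.trans_le hmn)

theorem Agree.zero (c d : Ser) : Agree 0 c d := fun _ hw => absurd hw (Nat.not_lt_zero _)

theorem Agree.add {n : ℕ} {c c' d d' : Ser} (h : Agree n c c') (h' : Agree n d d') :
    Agree n (c + d) (c' + d') :=
  fun w hw => congrArg₂ (· + ·) (h w hw) (h' w hw)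

theorem Agree.succ {n : ℕ} {c d : Ser} (h : c [] = d [])
    (h₀ : Agree n (shift 0 c) (shift 0 d)) (h₁ : Agree n (shift 1 c) (shift 1 d)) :
    Agree (n + 1) c d := by
  rintro (_ | ⟨i, w⟩) hw
  · exact h
  · have hw' : w.length < n := by simpa using hw
    fin_cases i
    · exact h₀ w hw'
    · exact h₁ w hw'

theorem Agree.shift {n : ℕ} {c d : Ser} (h : Agree (n + 1) c d) (i : Fin 2) :
    Agree n (shift i c) (shift i d) :=
  fun w hw => h (i :: w) (by simpa using hw)

theorem eq_of_agree {c d : Ser} (h : ∀ n, Agree n c d) : c = d :=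
  funext fun w => h (w.length + 1) w (Nat.lt_succ_self _)

@[simp] theorem shift_add (i : Fin 2) (c d : Ser) : shift i (c + d) = shift i c + shift i d := rfl

@[simp] theorem shift_neg (i : Fin 2) (c : Ser) : shift i (-c) = -shift i c := rfl

@[simp] theorem shift_zero (i : Fin 2) : shift i (0 : Ser) = 0 := rfl

@[simp] theorem shift_one1 (i : Fin 2) : shift i one1 = 0 := by
  funext w; simp [shift, one1]

@[simp] theorem one1_nil : one1 [] = 1 := if_pos rfl

/-! ### The shuffle algebra -/

@[simp] theorem sh_nil (c d : Ser) : sh c d [] = c [] * d [] := rfl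

@[simp] theorem shift_sh (i : Fin 2) (c d : Ser) :
    shift i (sh c d) = sh (shift i c) d + sh c (shift i d) := rfl

theorem sh_cons (i : Fin 2) (w : Word) (c d : Ser) :
    sh c d (i :: w) = sh (shift i c) d w + sh c (shift i d) w := rfl

theorem sh_comm (c d : Ser) : sh c d = sh d c := by
  funext w
  induction w generalizing c d with
  | nil => simp [mul_comm]
  | cons i w ih => rw [sh_cons, sh_cons, ih, ih c, add_comm]

theorem sh_add (c d e : Ser) : sh c (d + e) = sh c d + sh c e := by
  funext w
  induction w generalizing c d e with
  | nil => simp [mul_add]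
  | cons i w ih =>
    simp only [sh_cons, Pi.add_apply, shift_add, ih]
    ring

theorem add_sh (c d e : Ser) : sh (c + d) e = sh c e + sh d e := by
  rw [sh_comm, sh_add, sh_comm e, sh_comm e]

theorem sh_neg (c d : Ser) : sh c (-d) = -sh c d := by
  funext w
  induction w generalizing c d with
  | nil => simp
  | cons i w ih =>
    simp only [sh_cons, Pi.neg_apply, shift_neg, ih]
    ring

theorem neg_sh (c d : Ser) : sh (-c) d = -sh c d := by
  rw [sh_comm, sh_neg, sh_comm]

@[simp] theorem sh_zero (c : Ser) : sh c 0 = 0 := by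
  simpa using sh_add c 0 0

@[simp] theorem zero_sh (c : Ser) : sh 0 c = 0 := by rw [sh_comm, sh_zero]

@[simp] theorem one_sh (c : Ser) : sh one1 c = c := by
  funext w
  induction w generalizing c with
  | nil => simp
  | cons i w ih => simp [sh_cons, ih, shift]

@[simp] theorem sh_one (c : Ser) : sh c one1 = c := by rw [sh_comm, one_sh]

theorem sh_assoc (c d e : Ser) : sh (sh c d) e = sh c (sh d e) := by
  funext w
  induction w generalizing c d e with
  | nil => simp [mul_assoc]
  | cons i w ih =>
    simp only [sh_cons, shift_sh, sh_add, add_sh, Pi.add_apply, ih]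
    ring

theorem sh_left_comm (c d e : Ser) : sh c (sh d e) = sh d (sh c e) := by
  rw [← sh_assoc, sh_comm c, sh_assoc]

theorem Agree.sh {n : ℕ} {c c' d d' : Ser} (h : Agree n c c') (h' : Agree n d d') :
    Agree n (sh c d) (sh c' d') := by
  induction n generalizing c c' d d' with
  | zero => exact Agree.zero _ _
  | succ n ih =>
    refine Agree.succ (by simp [h [] (by simp), h' [] (by simp)]) ?_ ?_ <;>
    · simp only [shift_sh]
      exact (ih (h.shift _) (h'.mono n.le_succ)).add (ih (h.mono n.le_succ) (h'.shift _))

theorem hasSum_sh {ι : Type*} {f : ι → Ser} {s : Ser} (h : ∀ w, HasSum (fun k => f k w) (s w))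
    (c : Ser) (w : Word) : HasSum (fun k => sh c (f k) w) (sh c s w) := by
  induction w generalizing c f s with
  | nil => exact (h []).mul_left (c [])
  | cons i w ih => exact (ih h _).add (ih (fun u => h (i :: u)) c)

/-! ### The shuffle inverse -/

theorem shPow_eq_zero {p : Ser} (hp : p [] = 0) {k : ℕ} {w : Word} (h : w.length < k) :
    shPow p k w = 0 := by
  have key : ∀ k, Agree k (shPow p k) 0 := by
    intro k
    induction k with
    | zero => exact Agree.zero _ _
    | succ k ih =>
      have hq : ∀ (n : ℕ) (q r : Ser), q [] = 0 → Agree n r 0 →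
          Agree (n + 1) (_root_.sh q r) 0 := by
        intro n
        induction n with
        | zero =>
          intro q r hq _ w hw
          obtain rfl : w = [] := by simpa using hw
          simp [hq]
        | succ n ihn =>
          intro q r hq hr
          have h₁ : ∀ i, Agree (n + 1) (Ser.shift i (_root_.sh q r)) 0 := by
            intro i
            have := ((Agree.refl (n + 1) (Ser.shift i q)).sh hr).add
              (ihn q (Ser.shift i r) hq (hr.shift i))
            simpa using this
          exact Agree.succ (by simp [hq]) (h₁ 0) (h₁ 1)
      exact hq k p _ hp ih
  exact key k w h

theorem hasSum_shInv {c : Ser} (hc : c [] = 1) (w : Word) :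
    HasSum (fun k => shPow (one1 - c) k w) (shInv c w) := by
  refine Summable.hasSum (summable_of_hasFiniteSupport ((Set.finite_Iic w.length).subset ?_))
  intro k hk
  by_contra h
  exact hk (shPow_eq_zero (by simp [hc]) (by simpa using h))

theorem sh_shInv {c : Ser} (hc : c [] = 1) : sh c (shInv c) = one1 := by
  have h : shInv c = one1 + sh (one1 - c) (shInv c) := by
    funext w
    have h₁ := hasSum_shInv hc w
    have h₂ := hasSum_sh (hasSum_shInv hc) (one1 - c) w
    have h₃ := (hasSum_nat_add_iff' 1).2 h₁
    have h₄ := h₃.unique h₂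
    simp only [Finset.sum_range_one, shPow] at h₄
    simp only [Pi.add_apply, ← h₄]
    ring
  rw [sub_eq_add_neg, add_sh, one_sh, neg_sh] at h
  have h' : shInv c + sh c (shInv c) = shInv c + one1 := by
    nth_rewrite 1 [h]
    abel
  exact add_left_cancel h'

theorem shInv_sh {c : Ser} (hc : c [] = 1) : sh (shInv c) c = one1 := by
  rw [sh_comm, sh_shInv hc]

theorem shInv_nil {c : Ser} (hc : c [] = 1) : shInv c [] = 1 := by
  simpa [hc] using congrFun (sh_shInv hc) []

theorem eq_shInv {c d : Ser} (hc : c [] = 1) (h : sh c d = one1) : d = shInv c := by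
  rw [← one_sh d, ← shInv_sh hc, sh_assoc, h, sh_one]

/-! ### The mixed composition product -/

@[simp] theorem lc_nil (i : Fin 2) (c : Ser) : lc i c [] = 0 := rfl

@[simp] theorem shift_lc_self (i : Fin 2) (c : Ser) : shift i (lc i c) = c := by
  funext w; simp [shift, lc]

theorem shift_lc_of_ne {i j : Fin 2} (h : j ≠ i) (c : Ser) : shift j (lc i c) = 0 := by
  funext w; simp [shift, lc, h]

theorem wordMComp_eq_zero {d : Ser × Ser} {η w : Word} (h : w.length < η.length) :
    wordMComp η d w = 0 := by
  have key : ∀ η : Word, Agree η.length (wordMComp η d) 0 := by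
    intro η
    induction η with
    | nil => exact Agree.zero _ _
    | cons i η ih =>
      have hsh : ∀ a, Agree η.length (_root_.sh a (wordMComp η d)) 0 := fun a => by
        simpa using (Agree.refl _ a).sh ih
      fin_cases i
      · refine Agree.succ ?_ ?_ ?_
        · simp [wordMComp]
        · simpa [wordMComp] using ih
        · simpa [wordMComp, shift_lc_of_ne] using Agree.refl _ _
      · refine Agree.succ ?_ ?_ ?_
        · simp [wordMComp]
        · simpa [wordMComp, shift_lc_of_ne] using hsh d.2
        · simpa [wordMComp, shift_lc_of_ne] using hsh d.1
  exact key η w h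

theorem hasSum_mcomp (c : Ser) (d : Ser × Ser) (w : Word) :
    HasSum (fun η => c η * wordMComp η d w) (mcomp c d w) := by
  refine Summable.hasSum (summable_of_hasFiniteSupport
    ((List.finite_length_le (Fin 2) w.length).subset ?_))
  intro η hη
  by_contra h
  exact hη (by simp [wordMComp_eq_zero (d := d) (not_le.1 h)])

theorem hasSum_word {f : Word → ℝ} {a b : ℝ} (h₀ : HasSum (fun η => f (0 :: η)) a)
    (h₁ : HasSum (fun η => f (1 :: η)) b) : HasSum f (f [] + (a + b)) := by
  have key : ∀ (i : Fin 2) (a : ℝ), HasSum (fun η => f (i :: η)) a →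
      HasSum (fun η : Word => if η.head? = some i then f η else 0) a := by
    intro i a h
    refine ((List.cons_injective (a := i)).hasSum_iff ?_).1 (by simpa [Function.comp_def] using h)
    rintro (_ | ⟨j, η⟩) hη
    · simp
    · have : j ≠ i := by rintro rfl; exact hη ⟨η, rfl⟩
      simp [this]
  have h := (hasSum_ite_eq ([] : Word) (f [])).add ((key 0 a h₀).add (key 1 b h₁))
  convert h using 2 with η
  rcases η with _ | ⟨i, η⟩
  · simp
  · fin_cases i <;> simp

theorem hasSum_mul_sh (c a : Ser) (d : Ser × Ser) (w : Word) :
    HasSum (fun η => c η * sh a (wordMComp η d) w) (sh a (mcomp c d) w) := by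
  have hsmul : ∀ (r : ℝ) (w : Word) (a b : Ser), r * sh a b w = sh a (r • b) w := by
    intro r w
    induction w with
    | nil => intro a b; simp; ring
    | cons i w ih => intro a b; simp only [sh_cons, mul_add, ih]; rfl
  simp only [hsmul]
  exact hasSum_sh (hasSum_mcomp c d) a w

@[simp] theorem mcomp_nil (c : Ser) (d : Ser × Ser) : mcomp c d [] = c [] := by
  refine (hasSum_mcomp c d []).unique ?_
  convert hasSum_single (f := fun η => c η * wordMComp η d []) [] ?_ using 1
  · simp [wordMComp]
  · intro η hη
    rw [wordMComp_eq_zero (by simpa [List.length_pos_iff] using hη), mul_zero]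

theorem wordMComp_zero_cons (η : Word) (d : Ser × Ser) :
    wordMComp (0 :: η) d = lc 0 (wordMComp η d) := if_pos rfl

theorem wordMComp_one_cons (η : Word) (d : Ser × Ser) :
    wordMComp (1 :: η) d = lc 1 (sh d.1 (wordMComp η d)) + lc 0 (sh d.2 (wordMComp η d)) :=
  if_neg one_ne_zero

@[simp] theorem shift_zero_mcomp (c : Ser) (d : Ser × Ser) :
    shift 0 (mcomp c d) = mcomp (shift 0 c) d + sh d.2 (mcomp (shift 1 c) d) := by
  funext w
  refine (hasSum_mcomp c d (0 :: w)).unique ?_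
  convert hasSum_word (a := mcomp (shift 0 c) d w) (b := sh d.2 (mcomp (shift 1 c) d) w)
    ?_ ?_ using 1
  · simp [wordMComp, one1]
  · convert hasSum_mcomp (shift 0 c) d w using 2
    simp [wordMComp_zero_cons, lc, shift]
  · convert hasSum_mul_sh (shift 1 c) d.2 d w using 2
    simp [wordMComp_one_cons, lc, shift]

@[simp] theorem shift_one_mcomp (c : Ser) (d : Ser × Ser) :
    shift 1 (mcomp c d) = sh d.1 (mcomp (shift 1 c) d) := by
  funext w
  refine (hasSum_mcomp c d (1 :: w)).unique ?_
  convert hasSum_word (a := 0) (b := sh d.1 (mcomp (shift 1 c) d) w) ?_ ?_ using 1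
  · simp [wordMComp, one1]
  · simp [wordMComp_zero_cons, lc]
  · convert hasSum_mul_sh (shift 1 c) d.1 d w using 2
    simp [wordMComp_one_cons, lc, shift]

theorem add_mcomp (c c' : Ser) (d : Ser × Ser) : mcomp (c + c') d = mcomp c d + mcomp c' d := by
  funext w
  refine (hasSum_mcomp _ d w).unique ?_
  simpa [add_mul] using (hasSum_mcomp c d w).add (hasSum_mcomp c' d w)

@[simp] theorem zero_mcomp (d : Ser × Ser) : mcomp 0 d = 0 := by
  simpa using add_mcomp 0 0 d

@[simp] theorem one_mcomp (d : Ser × Ser) : mcomp one1 d = one1 := by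
  refine eq_of_agree fun n => ?_
  cases n with
  | zero => exact Agree.zero _ _
  | succ n => exact Agree.succ (by simp) (.of_eq (by simp)) (.of_eq (by simp))

theorem sh_mcomp (c c' : Ser) (d : Ser × Ser) :
    mcomp (sh c c') d = sh (mcomp c d) (mcomp c' d) := by
  refine eq_of_agree fun n => ?_
  induction n generalizing c c' with
  | zero => exact Agree.zero _ _
  | succ n ih =>
    have hs : ∀ i, Agree n (mcomp (shift i (sh c c')) d)
        (sh (mcomp (shift i c) d) (mcomp c' d) + sh (mcomp c d) (mcomp (shift i c') d)) := by
      intro i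
      rw [shift_sh, add_mcomp]
      exact (ih _ _).add (ih _ _)
    refine Agree.succ (by simp) ?_ ?_
    · rw [shift_zero_mcomp]
      refine ((hs 0).add ((Agree.refl n d.2).sh (hs 1))).trans (.of_eq ?_)
      simp only [shift_sh, shift_zero_mcomp, sh_add, add_sh, sh_assoc, sh_left_comm _ d.2]
      abel
    · rw [shift_one_mcomp]
      refine ((Agree.refl n d.1).sh (hs 1)).trans (.of_eq ?_)
      simp only [shift_sh, shift_one_mcomp, sh_add, sh_assoc, sh_left_comm _ d.1]

@[simp] theorem mcomp_eG (c : Ser) : mcomp c eG = c := by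
  refine eq_of_agree fun n => ?_
  induction n generalizing c with
  | zero => exact Agree.zero _ _
  | succ n ih =>
    refine Agree.succ (by simp) ?_ ?_
    · simpa [eG] using ih (shift 0 c)
    · simpa [eG] using ih (shift 1 c)

theorem mcomp_mcomp (c : Ser) (d e : Ser × Ser) :
    mcomp (mcomp c d) e = mcomp c (_root_.star d e) := by
  refine eq_of_agree fun n => ?_
  induction n generalizing c with
  | zero => exact Agree.zero _ _
  | succ n ih =>
    refine Agree.succ (by simp) ?_ ?_
    · simp only [shift_zero_mcomp, shift_one_mcomp, add_mcomp, sh_mcomp, _root_.star, odot, tri]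
      refine (((ih _).add ((Agree.refl _ _).sh (ih _))).add
        ((Agree.refl _ _).sh ((Agree.refl _ _).sh (ih _)))).trans (.of_eq ?_)
      simp only [add_sh, sh_assoc, _root_.star, odot, tri]
      abel
    · simp only [shift_one_mcomp, sh_mcomp, _root_.star, odot, tri]
      refine ((Agree.refl _ _).sh ((Agree.refl _ _).sh (ih _))).trans (.of_eq ?_)
      simp only [sh_assoc, sh_left_comm, _root_.star, odot, tri]

theorem Agree.mcomp {n : ℕ} {d d' : Ser × Ser} (h₁ : Agree n d.1 d'.1) (h₂ : Agree n d.2 d'.2)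
    (c : Ser) : Agree (n + 1) (mcomp c d) (mcomp c d') := by
  induction n generalizing c with
  | zero =>
    intro w hw
    obtain rfl : w = [] := by simpa using hw
    simp
  | succ n ih =>
    have ih' := ih (h₁.mono n.le_succ) (h₂.mono n.le_succ)
    refine Agree.succ (by simp) ?_ ?_
    · rw [shift_zero_mcomp, shift_zero_mcomp]
      exact (ih' _).add (h₂.sh (ih' _))
    · rw [shift_one_mcomp, shift_one_mcomp]
      exact h₁.sh (ih' _)

/-! ### The composition product -/

theorem comp_eq_mcomp (c d : Ser) : comp c d = mcomp c (0, d) := by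
  have h : ∀ η : Word, wordComp η d = wordMComp η (0, d) := by
    intro η
    induction η with
    | nil => rfl
    | cons i η ih =>
      have hlc : lc 1 0 = 0 := by funext w; cases w <;> simp [lc]
      simp [wordComp, wordMComp, ih, hlc]
  funext w
  simp only [comp, mcomp, h]

theorem comp_mcomp (a c : Ser) (d : Ser × Ser) :
    mcomp (comp a c) d = comp a (mcomp c d) := by
  rw [comp_eq_mcomp, comp_eq_mcomp, mcomp_mcomp]
  simp [_root_.star, odot, tri]

theorem bcomp_mcomp (a : Ser × Ser) (c : Ser) (d : Ser × Ser) :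
    tri (bcomp a c) d = bcomp a (mcomp c d) := by
  simp only [tri, bcomp, comp_mcomp]

theorem odot_bcomp (a b : Ser × Ser) (c : Ser) :
    bcomp (odot a b) c = odot (bcomp a c) (bcomp b c) := by
  simp only [bcomp, odot, comp_eq_mcomp, sh_mcomp, add_mcomp]

theorem inG_bcomp {d : Ser × Ser} (hd : inG d) (c : Ser) : inG (bcomp d c) := by
  simpa [inG, bcomp, comp_eq_mcomp] using hd

/-! ### The two group structures on `G` -/

theorem odot_assoc (a b c : Ser × Ser) : odot (odot a b) c = odot a (odot b c) := by
  refine Prod.ext (sh_assoc _ _ _) ?_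
  simp only [odot, add_sh, sh_assoc, sh_comm b.1, add_assoc]

theorem inG_odot {a b : Ser × Ser} (ha : inG a) (hb : inG b) : inG (odot a b) := by
  simp_all [inG, odot]

theorem inG_odotInv {a : Ser × Ser} (ha : inG a) : inG (odotInv a) := shInv_nil ha

theorem odotInv_odot {a b : Ser × Ser} (ha : inG a) (hb : inG b) :
    odotInv (odot a b) = odot (odotInv b) (odotInv a) := by
  have h : shInv (sh a.1 b.1) = sh (shInv b.1) (shInv a.1) := by
    refine (eq_shInv (inG_odot ha hb) ?_).symm
    rw [odot, sh_assoc, ← sh_assoc b.1, sh_shInv hb, one_sh, sh_shInv ha]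
  refine Prod.ext h ?_
  simp only [odotInv, odot, h, sh_add, neg_sh]
  have h' : sh (sh (shInv b.1) (shInv a.1)) (sh b.2 a.1) = sh (shInv b.1) b.2 := by
    rw [sh_comm b.2, sh_assoc, ← sh_assoc (shInv a.1), shInv_sh ha, one_sh]
  rw [h', sh_assoc, sh_comm (shInv b.1) (sh _ _)]
  abel

theorem tri_star (a b c : Ser × Ser) : tri (tri a b) c = tri a (_root_.star b c) := by
  simp only [tri, mcomp_mcomp]

theorem tri_odot (a b c : Ser × Ser) : tri (odot a b) c = odot (tri a c) (tri b c) := by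
  simp only [tri, odot, sh_mcomp, add_mcomp]

theorem star_assoc (a b c : Ser × Ser) :
    _root_.star (_root_.star a b) c = _root_.star a (_root_.star b c) := by
  rw [_root_.star, _root_.star, tri_odot, odot_assoc, tri_star]
  rfl

@[simp] theorem odot_eG (a : Ser × Ser) : odot a eG = a := by simp [odot, eG]

@[simp] theorem eG_odot (a : Ser × Ser) : odot eG a = a := by simp [odot, eG]

@[simp] theorem star_eG (a : Ser × Ser) : _root_.star a eG = a := by simp [_root_.star, tri]

@[simp] theorem eG_star (a : Ser × Ser) : _root_.star eG a = a := by
  have : tri eG a = eG := by simp [tri, eG]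
  rw [_root_.star, this, eG_odot]

theorem inG_star {a b : Ser × Ser} (ha : inG a) (hb : inG b) : inG (_root_.star a b) := by
  simp_all [inG, _root_.star, odot, tri]

theorem odot_odotInv {a : Ser × Ser} (ha : inG a) : odot a (odotInv a) = eG := by
  refine Prod.ext (sh_shInv ha) ?_
  simp only [odot, odotInv, eG, neg_sh]
  rw [sh_comm (sh _ _), ← sh_assoc, sh_shInv ha, one_sh, add_neg_cancel]

/-- The contraction `y ↦ a ⊲ y` has a fixed point. -/
theorem exists_tri_eq_self (a : Ser × Ser) : ∃ y, tri a y = y := by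
  let it : ℕ → Ser × Ser := fun n => (tri a)^[n] eG
  have hit : ∀ n, it (n + 1) = tri a (it n) := fun n => Function.iterate_succ_apply' _ _ _
  have step : ∀ n, Agree n (it n).1 (it (n + 1)).1 ∧ Agree n (it n).2 (it (n + 1)).2 := by
    intro n
    induction n with
    | zero => exact ⟨Agree.zero _ _, Agree.zero _ _⟩
    | succ n ih =>
      rw [hit (n + 1), hit n]
      have h := fun c => Agree.mcomp ih.1 ih.2 c
      rw [hit n] at h
      exact ⟨h _, h _⟩
  have le : ∀ n m, n ≤ m → Agree n (it n).1 (it m).1 ∧ Agree n (it n).2 (it m).2 := by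
    intro n m h
    induction m, h using Nat.le_induction with
    | base => exact ⟨Agree.refl _ _, Agree.refl _ _⟩
    | succ m h ih => exact ⟨ih.1.trans ((step m).1.mono h), ih.2.trans ((step m).2.mono h)⟩
  let y : Ser × Ser := (fun w => (it (w.length + 1)).1 w, fun w => (it (w.length + 1)).2 w)
  have hy₁ : ∀ n, Agree n y.1 (it n).1 := fun n w hw => (le _ n hw).1 w (Nat.lt_succ_self _)
  have hy₂ : ∀ n, Agree n y.2 (it n).2 := fun n w hw => (le _ n hw).2 w (Nat.lt_succ_self _)
  have key : ∀ n c, Agree n (mcomp c y) (mcomp c (it n)) := fun n c =>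
    (Agree.mcomp (hy₁ n) (hy₂ n) c).mono n.le_succ
  refine ⟨y, Prod.ext (eq_of_agree fun n => ?_) (eq_of_agree fun n => ?_)⟩
  · refine (key n _).trans (.trans (.of_eq ?_) ((hy₁ (n + 1)).mono n.le_succ).symm)
    exact (congrArg Prod.fst (hit n)).symm
  · refine (key n _).trans (.trans (.of_eq ?_) ((hy₂ (n + 1)).mono n.le_succ).symm)
    exact (congrArg Prod.snd (hit n)).symm

theorem exists_star_eq_eG {a : Ser × Ser} (ha : inG a) : ∃ y, inG y ∧ _root_.star a y = eG := by
  obtain ⟨y, hy⟩ := exists_tri_eq_self (odotInv a)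
  refine ⟨y, ?_, ?_⟩
  · rw [← hy]
    simpa [inG, tri] using inG_odotInv ha
  · rw [_root_.star]
    nth_rewrite 2 [← hy]
    rw [← tri_odot, odot_odotInv ha]
    simp [tri, eG]

theorem starInv_spec {a : Ser × Ser} (ha : inG a) :
    inG (starInv a) ∧ _root_.star a (starInv a) = eG ∧ _root_.star (starInv a) a = eG := by
  have h : ∃ y : Ser × Ser, inG y ∧ _root_.star a y = eG ∧ _root_.star y a = eG := by
    obtain ⟨y, hy, hay⟩ := exists_star_eq_eG ha
    obtain ⟨z, -, hyz⟩ := exists_star_eq_eG hy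
    have haz : a = z := by rw [← star_eG a, ← hyz, ← star_assoc, hay, eG_star]
    exact ⟨y, hy, hay, by rwa [haz]⟩
  rw [starInv, dif_pos h]
  exact h.choose_spec

theorem starInv_star {a b : Ser × Ser} (ha : inG a) (hb : inG b) :
    starInv (_root_.star a b) = _root_.star (starInv b) (starInv a) := by
  have h := (starInv_spec (inG_star ha hb)).2.2
  calc starInv (_root_.star a b)
      = _root_.star (_root_.star (starInv (_root_.star a b)) (_root_.star a b))
          (_root_.star (starInv b) (starInv a)) := by
        rw [star_assoc, star_assoc a, ← star_assoc b, (starInv_spec hb).2.1, eG_star,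
          (starInv_spec ha).2.1, star_eG]
    _ = _ := by rw [h, eG_star]

/-! ### The affine feedback product -/

/-- The affine feedback product is a right action of `(G, ⊙)`. -/
theorem atp_atp (c : Ser) {d e : Ser × Ser} (hd : inG d) (he : inG e) :
    atp (atp c d) e = atp c (odot d e) := by
  have hx := inG_bcomp (inG_odotInv hd) c
  have hz := inG_bcomp (inG_odotInv he) (atp c d)
  have h : _root_.star (bcomp (odotInv e) (atp c d)) (bcomp (odotInv d) c)
      = bcomp (odotInv (odot d e)) c := by
    rw [odotInv_odot hd he, odot_bcomp, _root_.star, atp, bcomp_mcomp, mcomp_mcomp,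
      (starInv_spec hx).2.2, mcomp_eG]
  rw [atp.eq_1 c (odot d e), ← h, starInv_star hz hx, ← mcomp_mcomp]
  rfl

end Ser

/-- structural non-commutativity of additive and
multiplicative feedback loops.  For every plant `c ∈ ℝ⟨⟨X⟩⟩`, every
`d₁ ∈ M` and every `d₂ ∈ ℝ⟨⟨X⟩⟩`, the four successive feedbacks satisfy
`(((c @ (𝟙, d₂)) @ (d₁, 0)) @ (𝟙, -d₂)) @ (d₁^{⧢-1}, 0)
  = c @ (𝟙, d₂ ⧢ (𝟙 - d₁))`,
i.e. the loops do not cancel but leave a residual additive feedback by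
`d₂ ⧢ (𝟙 - d₁)`. -/
theorem structural_noncommutativity (c : Ser) (d₁ : Ser) (hd₁ : d₁ [] = 1)
    (d₂ : Ser) :
    atp (atp (atp (atp c ((one1, d₂) : Ser × Ser)) ((d₁, 0) : Ser × Ser))
        ((one1, -d₂) : Ser × Ser)) ((shInv d₁, 0) : Ser × Ser)
      = atp c ((one1, sh d₂ (one1 - d₁)) : Ser × Ser) := by
  have h₁ : inG ((one1, d₂) : Ser × Ser) := Ser.one1_nil
  have h₂ : inG ((d₁, 0) : Ser × Ser) := hd₁
  have h₃ : inG ((one1, -d₂) : Ser × Ser) := Ser.one1_nil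
  have h₄ : inG ((shInv d₁, 0) : Ser × Ser) := Ser.shInv_nil hd₁
  rw [Ser.atp_atp c h₁ h₂, Ser.atp_atp c (Ser.inG_odot h₁ h₂) h₃,
    Ser.atp_atp c (Ser.inG_odot (Ser.inG_odot h₁ h₂) h₃) h₄]
  congr 1
  simp [odot, Ser.sh_shInv hd₁, Ser.neg_sh, Ser.sh_neg, Ser.sh_add, sub_eq_add_neg]
end
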